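/- arXiv:0905.1388 — 2 statements merged into one kernel-verified Lean document; each statement's English description precedes it below -/
import Mathlib

section
/- Let d ≥ 3 be an integer and μ > 0. For every z > 0, setting w = f_{d/2−1}^(−1)(2z/μ), the Fermi–Dirac pressure P_FD is differentiable at z with derivative P_FD'(z) = f_{d/2−1}(w) / ( (d/2 − 1)·f_{d/2−2}(w) ). -/
open Set MeasureTheory Function

/-- The Fermi function of order `α`. -/
noncomputable def fermi (α z : ℝ) : ℝ :=
  ∫ x in Set.Ioi (0:ℝ), x ^ α / (1 + Real.exp (x - z))

/-- The Fermi--Dirac pressure. -/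
noncomputable def fermiDiracPressure (d : ℕ) (μ : ℝ) (z : ℝ) : ℝ :=
  (μ / d) * fermi ((d : ℝ) / 2)
    (Function.invFun (fermi ((d : ℝ) / 2 - 1)) (2 * z / μ))

open Filter Topology

theorem fermi_weight_le (x z : ℝ) : 1 / (1 + Real.exp (x - z)) ≤ Real.exp z * Real.exp (-x) := by
  rw [div_le_iff₀ (by positivity), mul_add, ← Real.exp_add, ← Real.exp_add]
  have : z + -x + (x - z) = 0 := by ring
  rw [this, Real.exp_zero]
  have := Real.exp_pos (z + -x)
  linarith

theorem fermi_gamma_integrable (α : ℝ) (hα : -1 < α) (c : ℝ) :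
    IntegrableOn (fun x : ℝ => x ^ α * (c * Real.exp (-x))) (Ioi 0) := by
  have h := (Real.GammaIntegral_convergent (s := α + 1) (by linarith)).const_mul c
  refine h.congr (Eventually.of_forall fun x => ?_)
  simp only [add_sub_cancel_right]
  ring

theorem fermi_meas (α z : ℝ) :
    Measurable (fun x : ℝ => x ^ α / (1 + Real.exp (x - z))) := by
  fun_prop

theorem fermi_bound (α z x : ℝ) (hx : 0 < x) :
    x ^ α / (1 + Real.exp (x - z)) ≤ x ^ α * (Real.exp z * Real.exp (-x)) := by
  rw [div_eq_mul_one_div]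
  have := Real.rpow_nonneg hx.le α
  exact mul_le_mul_of_nonneg_left (fermi_weight_le x z) this

theorem fermi_nonneg_integrand (α z x : ℝ) (hx : 0 < x) :
    0 ≤ x ^ α / (1 + Real.exp (x - z)) := by positivity

theorem fermi_integrable (α : ℝ) (hα : -1 < α) (z : ℝ) :
    IntegrableOn (fun x : ℝ => x ^ α / (1 + Real.exp (x - z))) (Ioi 0) := by
  refine (fermi_gamma_integrable α hα (Real.exp z)).mono' (fermi_meas α z).aestronglyMeasurable ?_
  refine (ae_restrict_iff' measurableSet_Ioi).2 (Eventually.of_forall fun x hx => ?_)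
  rw [Real.norm_of_nonneg (fermi_nonneg_integrand α z x hx)]
  exact fermi_bound α z x hx

theorem fermi_pos (α : ℝ) (hα : -1 < α) (z : ℝ) : 0 < fermi α z := by
  unfold fermi
  rw [setIntegral_pos_iff_support_of_nonneg_ae _ (fermi_integrable α hα z)]
  · have : support (fun x : ℝ => x ^ α / (1 + Real.exp (x - z))) ∩ Ioi 0 = Ioi 0 := by
      refine inter_eq_right.2 fun x hx => ?_
      have hx : 0 < x := hx
      have : 0 < x ^ α / (1 + Real.exp (x - z)) := by positivity
      exact this.ne'
    rw [this]
    simp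
  · exact (ae_restrict_iff' measurableSet_Ioi).2
      (Eventually.of_forall fun x hx => fermi_nonneg_integrand α z x hx)

theorem fermi_deriv_bound (x z : ℝ) :
    Real.exp (x - z) / (1 + Real.exp (x - z)) ^ 2 ≤ Real.exp z * Real.exp (-x) := by
  refine le_trans ?_ (fermi_weight_le x z)
  have := Real.exp_pos (x - z)
  rw [div_le_div_iff₀ (by positivity) (by positivity)]
  nlinarith

theorem fermi_ibp (α : ℝ) (hα : 0 < α) (z : ℝ)
    (hInt : IntegrableOn
      (fun x : ℝ => x ^ α * (Real.exp (x - z) / (1 + Real.exp (x - z)) ^ 2)) (Ioi 0)) :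
    ∫ x in Ioi (0:ℝ), x ^ α * (Real.exp (x - z) / (1 + Real.exp (x - z)) ^ 2)
      = α * fermi (α - 1) z := by
  have key := integral_Ioi_mul_deriv_eq_deriv_mul (a := (0:ℝ)) (a' := (0:ℝ)) (b' := (0:ℝ))
    (u := fun x : ℝ => x ^ α) (u' := fun x : ℝ => α * x ^ (α - 1))
    (v := fun x : ℝ => -(1 + Real.exp (x - z))⁻¹)
    (v' := fun x : ℝ => Real.exp (x - z) / (1 + Real.exp (x - z)) ^ 2)
    (fun x hx => Real.hasDerivAt_rpow_const (Or.inl (ne_of_gt hx)))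
    (fun x hx => by
      have h1 : HasDerivAt (fun x : ℝ => 1 + Real.exp (x - z)) (Real.exp (x - z)) x := by
        simpa using (((hasDerivAt_id x).sub_const z).exp).const_add 1
      have := (h1.inv (by positivity)).neg
      convert! this using 1
      ring)
    hInt
    (by
      refine ((fermi_integrable (α - 1) (by linarith) z).const_mul (-α)).congr
        (Eventually.of_forall fun x => ?_)
      simp only [Pi.mul_apply, div_eq_mul_inv]
      ring)
    (by
      have hc : ContinuousAt ((fun x : ℝ => x ^ α) * (fun x : ℝ => -(1 + Real.exp (x - z))⁻¹)) 0 := by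
        refine ContinuousAt.mul (Real.continuousAt_rpow_const 0 α (Or.inr hα.le)) ?_
        refine (ContinuousAt.inv₀ (by fun_prop) (by positivity)).neg
      have := hc.tendsto.mono_left (nhdsWithin_le_nhds (s := Ioi 0))
      simpa [Real.zero_rpow hα.ne'] using this)
    (by
      have h := (tendsto_rpow_mul_exp_neg_mul_atTop_nhds_zero α 1 one_pos).const_mul (Real.exp z)
      rw [mul_zero] at h
      refine squeeze_zero_norm' ?_ h
      filter_upwards [eventually_gt_atTop 0] with x hx
      have h1 := fermi_bound α z x hx
      have h2 := fermi_nonneg_integrand α z x hx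
      have : ((fun x : ℝ => x ^ α) * (fun x : ℝ => -(1 + Real.exp (x - z))⁻¹)) x
          = -(x ^ α / (1 + Real.exp (x - z))) := by
        simp [div_eq_mul_inv]
      rw [this, norm_neg, Real.norm_of_nonneg h2]
      refine h1.trans (le_of_eq ?_)
      rw [neg_one_mul]
      ring)
  rw [key, fermi, ← integral_const_mul, sub_zero, zero_sub, ← integral_neg]
  congr 1
  ext x
  rw [div_eq_mul_inv]
  ring

theorem fermi_hasDerivAt (α : ℝ) (hα : 0 < α) (w : ℝ) :
    HasDerivAt (fermi α) (α * fermi (α - 1) w) w := by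
  have h := hasDerivAt_integral_of_dominated_loc_of_deriv_le
    (μ := volume.restrict (Ioi (0:ℝ))) (x₀ := w) (s := Metric.ball w 1)
    (F := fun z x : ℝ => x ^ α / (1 + Real.exp (x - z)))
    (F' := fun z x : ℝ => x ^ α * (Real.exp (x - z) / (1 + Real.exp (x - z)) ^ 2))
    (bound := fun x : ℝ => x ^ α * (Real.exp (w + 1) * Real.exp (-x)))
    (Metric.ball_mem_nhds w one_pos)
    (Eventually.of_forall fun z => (fermi_meas α z).aestronglyMeasurable)
    (fermi_integrable α (by linarith) w)
    (by
      apply Measurable.aestronglyMeasurable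
      fun_prop)
    (by
      refine (ae_restrict_iff' measurableSet_Ioi).2 (Eventually.of_forall fun x hx z hz => ?_)
      have hx : 0 < x := hx
      rw [Real.norm_of_nonneg (by positivity)]
      refine mul_le_mul_of_nonneg_left ((fermi_deriv_bound x z).trans ?_)
        (Real.rpow_nonneg hx.le α)
      refine mul_le_mul_of_nonneg_right (Real.exp_le_exp.2 ?_) (Real.exp_pos _).le
      have := (abs_lt.1 (Real.dist_eq z w ▸ Metric.mem_ball.1 hz)).2
      linarith)
    (fermi_gamma_integrable α (by linarith) _)
    (Eventually.of_forall fun x z _ => by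
      have h1 : HasDerivAt (fun z : ℝ => 1 + Real.exp (x - z)) (-Real.exp (x - z)) z := by
        simpa using (((hasDerivAt_id z).const_sub x).exp).const_add 1
      have := (h1.inv (by positivity)).const_mul (x ^ α)
      convert! this using 1
      ring)
  rw [← fermi_ibp α hα w h.1]
  exact h.2

theorem fermi_strictMono (α : ℝ) (hα : 0 < α) : StrictMono (fermi α) := by
  refine strictMono_of_deriv_pos fun w => ?_
  rw [(fermi_hasDerivAt α hα w).deriv]
  exact mul_pos hα (fermi_pos _ (by linarith) w)

theorem fermi_lower (α : ℝ) (hα : 0 < α) (z : ℝ) (hz : 1 ≤ z) : (z - 1) / 2 ≤ fermi α z := by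
  have hi := fermi_integrable α (by linarith) z
  have hsub : Ioc 1 z ⊆ Ioi (0:ℝ) := fun x hx => lt_trans one_pos hx.1
  have h1 : ∫ x in Ioc 1 z, x ^ α / (1 + Real.exp (x - z)) ≤ fermi α z :=
    setIntegral_mono_set hi ((ae_restrict_iff' measurableSet_Ioi).2
      (Eventually.of_forall fun x hx => fermi_nonneg_integrand α z x hx))
      hsub.eventuallyLE
  have h2 : ∫ x in Ioc 1 z, (1 / 2 : ℝ) ≤ ∫ x in Ioc 1 z, x ^ α / (1 + Real.exp (x - z)) := by
    refine setIntegral_mono_on (by simp) (hi.mono_set hsub) measurableSet_Ioc fun x hx => ?_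
    have h3 : 1 ≤ x ^ α := Real.one_le_rpow hx.1.le hα.le
    have h4 : Real.exp (x - z) ≤ 1 := Real.exp_le_one_iff.2 (by linarith [hx.2])
    have := Real.exp_pos (x - z)
    rw [div_le_div_iff₀ (by norm_num) (by positivity)]
    nlinarith
  have h5 : ∫ x in Ioc 1 z, (1 / 2 : ℝ) = (z - 1) / 2 := by
    simp [hz]
    ring
  linarith

theorem fermi_upper (α : ℝ) (hα : 0 < α) (z : ℝ) :
    fermi α z ≤ Real.exp z * ∫ x in Ioi (0:ℝ), x ^ α * (1 * Real.exp (-x)) := by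
  rw [← integral_const_mul]
  refine setIntegral_mono_on (fermi_integrable α (by linarith) z)
    ((fermi_gamma_integrable α (by linarith) 1).const_mul _) measurableSet_Ioi fun x hx => ?_
  refine (fermi_bound α z x hx).trans (le_of_eq (by ring))

theorem fermi_surj (α : ℝ) (hα : 0 < α) (y : ℝ) (hy : 0 < y) : ∃ w, fermi α w = y := by
  have hc : Continuous (fermi α) :=
    continuous_iff_continuousAt.2 fun w => (fermi_hasDerivAt α hα w).continuousAt
  set C := ∫ x in Ioi (0:ℝ), x ^ α * (1 * Real.exp (-x)) with hC
  have ht : Tendsto (fun z => Real.exp z * C) atBot (𝓝 0) := by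
    simpa using Real.tendsto_exp_atBot.mul_const C
  obtain ⟨a, ha⟩ := (ht.eventually (gt_mem_nhds hy)).exists
  have ha' : fermi α a ≤ y := (fermi_upper α hα a).trans ha.le
  have hb : y ≤ fermi α (2 * y + 1) :=
    le_trans (by linarith) (fermi_lower α hα (2 * y + 1) (by linarith))
  exact mem_range_of_exists_le_of_exists_ge hc ⟨a, ha'⟩ ⟨_, hb⟩

theorem fermi_inv_hasDerivAt (α : ℝ) (hα : 0 < α) (y : ℝ) (hy : 0 < y) :
    HasDerivAt (invFun (fermi α)) (α * fermi (α - 1) (invFun (fermi α) y))⁻¹ y := by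
  have hmono := fermi_strictMono α hα
  have hr : ∀ y, 0 < y → fermi α (invFun (fermi α) y) = y := fun y hy =>
    invFun_eq (fermi_surj α hα y hy)
  have hl : ∀ w, invFun (fermi α) (fermi α w) = w := leftInverse_invFun hmono.injective
  have hcont : ContinuousAt (invFun (fermi α)) y := by
    refine StrictMonoOn.continuousAt_of_image_mem_nhds (s := Ioi 0) ?_ (Ioi_mem_nhds hy) ?_
    · intro a ha b hb hab
      rw [← hmono.lt_iff_lt, hr a ha, hr b hb]
      exact hab
    · convert univ_mem
      exact eq_univ_of_forall fun w => ⟨fermi α w, fermi_pos α (by linarith) w, hl w⟩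
  refine HasDerivAt.of_local_left_inverse hcont (fermi_hasDerivAt α hα _) ?_ ?_
  · exact (mul_pos hα (fermi_pos _ (by linarith) _)).ne'
  · filter_upwards [Ioi_mem_nhds hy] with x hx using hr x hx

theorem fermiDiracPressure_hasDerivAt
    (d : ℕ) (hd : 3 ≤ d) (μ : ℝ) (hμ : 0 < μ) (z : ℝ) (hz : 0 < z) :
    HasDerivAt (fermiDiracPressure d μ)
      (fermi ((d : ℝ) / 2 - 1) (Function.invFun (fermi ((d : ℝ) / 2 - 1)) (2 * z / μ)) /
        (((d : ℝ) / 2 - 1) *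
          fermi ((d : ℝ) / 2 - 2)
            (Function.invFun (fermi ((d : ℝ) / 2 - 1)) (2 * z / μ)))) z := by
  have hd' : (3:ℝ) ≤ d := by exact_mod_cast hd
  have h0 : HasDerivAt (fun z : ℝ => 2 * z / μ) (2 / μ) z := by
    simpa using ((hasDerivAt_id z).const_mul 2).div_const μ
  have h1 := fermi_inv_hasDerivAt ((d : ℝ) / 2 - 1) (by linarith) (2 * z / μ) (by positivity)
  have h2 := HasDerivAt.comp z h1 h0
  have h3 := fermi_hasDerivAt ((d : ℝ) / 2) (by linarith)
    (invFun (fermi ((d : ℝ) / 2 - 1)) (2 * z / μ))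
  have h4 := (HasDerivAt.comp z h3 h2).const_mul (μ / d)
  have e : (d : ℝ) / 2 - 1 - 1 = d / 2 - 2 := by ring
  rw [e] at h4
  convert! h4 using 1
  have hp := fermi_pos ((d : ℝ) / 2 - 2) (by linarith)
    (invFun (fermi ((d : ℝ) / 2 - 1)) (2 * z / μ))
  generalize fermi ((d : ℝ) / 2 - 2) (invFun (fermi ((d : ℝ) / 2 - 1)) (2 * z / μ)) = A at *
  generalize fermi ((d : ℝ) / 2 - 1) (invFun (fermi ((d : ℝ) / 2 - 1)) (2 * z / μ)) = B at *
  have hq : (d : ℝ) / 2 - 1 ≠ 0 := by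
    have : (0:ℝ) < d / 2 - 1 := by linarith
    exact this.ne'
  generalize (d : ℝ) / 2 - 1 = q at *
  have hd0 : (d : ℝ) ≠ 0 := by positivity
  field_simp
end

section
/- Let d ≥ 2 be an integer and μ > 0. The function z ↦ P_FD(z)·z^(−(1+2/d)) is strictly decreasing on (0,∞). -/
open Set MeasureTheory Function

lemma fermi_aux_pos (φ : ℝ → ℝ) (t : ℝ) (ht : 0 < t) (hi : IntegrableOn φ (Ioi 0))
    (h0 : ∀ x ∈ Ioi (0:ℝ), 0 ≤ φ x) (hp : ∀ x ∈ Ioo (0:ℝ) t, 0 < φ x) :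
    0 < ∫ x in Ioi (0:ℝ), φ x := by
  rw [setIntegral_pos_iff_support_of_nonneg_ae]
  · have h1 : Ioo (0:ℝ) t ⊆ Function.support φ ∩ Ioi 0 := by
      intro x hx
      exact ⟨(hp x hx).ne', hx.1⟩
    refine lt_of_lt_of_le ?_ (measure_mono h1)
    simp [ht]
  · filter_upwards [ae_restrict_mem measurableSet_Ioi] with x hx using h0 x hx
  · exact hi

lemma fermi_aux_gamma (β : ℝ) (hβ : -1 < β) :
    IntegrableOn (fun x : ℝ => Real.exp (-x) * x ^ β) (Ioi 0) := by
  have := Real.GammaIntegral_convergent (s := β + 1) (by linarith)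
  simpa using this

lemma fermi_aux_bound (β c z x : ℝ) (hc : 1 ≤ c) (hx : 0 < x) :
    x ^ β / (1 + Real.exp (c * x - z)) ≤ Real.exp z * (Real.exp (-x) * x ^ β) := by
  have h1 : 0 < x ^ β := Real.rpow_pos_of_pos hx β
  rw [div_le_iff₀ (by positivity)]
  have h2 : Real.exp (x - z) ≤ Real.exp (c * x - z) := by
    apply Real.exp_le_exp.2; nlinarith
  have h3 : Real.exp z * Real.exp (-x) * Real.exp (x - z) = 1 := by
    rw [← Real.exp_add, ← Real.exp_add, Real.exp_eq_one_iff]; ring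
  have h4 : 1 ≤ Real.exp z * Real.exp (-x) * (1 + Real.exp (c * x - z)) := by
    have h5 : 0 < Real.exp z * Real.exp (-x) := by positivity
    nlinarith
  nlinarith

lemma fermi_aux_meas (β c z : ℝ) :
    Measurable (fun x : ℝ => x ^ β / (1 + Real.exp (c * x - z))) := by
  fun_prop

lemma fermi_aux_int (β c z : ℝ) (hβ : -1 < β) (hc : 1 ≤ c) :
    IntegrableOn (fun x : ℝ => x ^ β / (1 + Real.exp (c * x - z))) (Ioi 0) := by
  refine Integrable.mono' ((fermi_aux_gamma β hβ).const_mul (Real.exp z))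
    (fermi_aux_meas β c z).aestronglyMeasurable ?_
  filter_upwards [ae_restrict_mem measurableSet_Ioi] with x hx
  have hx' : 0 < x := hx
  have h1 : 0 < x ^ β := Real.rpow_pos_of_pos hx' β
  rw [Real.norm_of_nonneg (by positivity)]
  exact fermi_aux_bound β c z x hc hx

lemma fermi_int (β z : ℝ) (hβ : -1 < β) :
    IntegrableOn (fun x : ℝ => x ^ β / (1 + Real.exp (x - z))) (Ioi 0) := by
  simpa using fermi_aux_int β 1 z hβ le_rfl

lemma fermi_pos_s15 (β z : ℝ) (hβ : -1 < β) : 0 < fermi β z := by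
  refine fermi_aux_pos _ 1 one_pos (fermi_int β z hβ) ?_ ?_
  · intro x hx
    have h1 : 0 < x ^ β := Real.rpow_pos_of_pos hx β
    positivity
  · intro x hx
    have h1 : 0 < x ^ β := Real.rpow_pos_of_pos hx.1 β
    positivity

lemma fermi_strictMono_s15 (β : ℝ) (hβ : -1 < β) : StrictMono (fermi β) := by
  intro a b hab
  rw [← sub_pos]
  unfold fermi
  rw [← integral_sub (fermi_int β b hβ) (fermi_int β a hβ)]
  have key : ∀ x ∈ Ioi (0:ℝ), 0 < x ^ β / (1 + Real.exp (x - b)) - x ^ β / (1 + Real.exp (x - a)) := by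
    intro x hx
    have h1 : 0 < x ^ β := Real.rpow_pos_of_pos hx β
    rw [sub_pos]
    apply div_lt_div_of_pos_left h1 (by positivity)
    have : Real.exp (x - b) < Real.exp (x - a) := Real.exp_lt_exp.2 (by linarith)
    linarith
  exact fermi_aux_pos _ 1 one_pos ((fermi_int β b hβ).sub (fermi_int β a hβ))
    (fun x hx => (key x hx).le) (fun x hx => key x hx.1)

lemma fermi_scale (β c z : ℝ) (hc : 0 < c) :
    fermi β z = c ^ (β + 1) * ∫ x in Ioi (0:ℝ), x ^ β / (1 + Real.exp (c * x - z)) := by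
  have h := integral_comp_mul_left_Ioi (fun x : ℝ => x ^ β / (1 + Real.exp (x - z))) 0 hc
  rw [mul_zero, smul_eq_mul] at h
  have h2 : ∫ x in Ioi (0:ℝ), (c * x) ^ β / (1 + Real.exp (c * x - z))
      = c ^ β * ∫ x in Ioi (0:ℝ), x ^ β / (1 + Real.exp (c * x - z)) := by
    rw [← integral_const_mul]
    apply setIntegral_congr_fun measurableSet_Ioi
    intro x hx
    have hx' : 0 < x := hx
    simp only
    rw [Real.mul_rpow hc.le hx'.le, mul_div_assoc]
  rw [h2] at h
  unfold fermi
  rw [Real.rpow_add hc, Real.rpow_one, mul_right_comm, h]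
  field_simp

lemma fermi_continuous (β : ℝ) (hβ : -1 < β) : Continuous (fermi β) := by
  rw [continuous_iff_continuousAt]
  intro z
  unfold fermi
  refine continuousAt_of_dominated
    (bound := fun x => Real.exp (z + 1) * (Real.exp (-x) * x ^ β)) ?_ ?_ ?_ ?_
  · exact Filter.Eventually.of_forall fun y => by
      simpa using (fermi_aux_meas β 1 y).aestronglyMeasurable
  · filter_upwards [Iio_mem_nhds (show z < z + 1 by linarith)] with y hy
    filter_upwards [ae_restrict_mem measurableSet_Ioi] with x hx
    have hx' : 0 < x := hx
    have h1 : 0 < x ^ β := Real.rpow_pos_of_pos hx' β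
    rw [Real.norm_of_nonneg (by positivity)]
    have h2 := fermi_aux_bound β 1 y x le_rfl hx
    rw [one_mul] at h2
    refine h2.trans ?_
    have : Real.exp y ≤ Real.exp (z + 1) := Real.exp_le_exp.2 (le_of_lt hy)
    gcongr
  · exact (fermi_aux_gamma β hβ).const_mul _
  · refine Filter.Eventually.of_forall fun x => ?_
    refine ContinuousAt.div (by fun_prop) (by fun_prop) (by positivity)

lemma fermi_le (β z : ℝ) (hβ : -1 < β) :
    fermi β z ≤ Real.exp z * ∫ x in Ioi (0:ℝ), Real.exp (-x) * x ^ β := by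
  rw [← integral_const_mul]
  apply setIntegral_mono_on (fermi_int β z hβ) ((fermi_aux_gamma β hβ).const_mul _) measurableSet_Ioi
  intro x hx
  simpa using fermi_aux_bound β 1 z x le_rfl hx

lemma fermi_ge (β z : ℝ) (hβ : -1 < β) (hz : 0 < z) :
    z ^ (β + 1) / (β + 1) / 2 ≤ fermi β z := by
  have h1 : ∫ x in (0:ℝ)..z, x ^ β = z ^ (β + 1) / (β + 1) := by
    rw [integral_rpow (Or.inl hβ), Real.zero_rpow (by linarith), sub_zero]
  rw [← h1, intervalIntegral.integral_of_le hz.le, ← integral_div]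
  have hI : IntegrableOn (fun x : ℝ => x ^ β / 2) (Ioc 0 z) := by
    have := intervalIntegral.intervalIntegrable_rpow' (a := 0) (b := z) hβ
    exact ((intervalIntegrable_iff_integrableOn_Ioc_of_le hz.le).1 this).div_const 2
  refine (setIntegral_mono_on hI ((fermi_int β z hβ).mono_set Ioc_subset_Ioi_self)
    measurableSet_Ioc ?_).trans ?_
  · intro x hx
    have h1 : 0 < x ^ β := Real.rpow_pos_of_pos hx.1 β
    apply div_le_div_of_nonneg_left h1.le (by positivity)
    have : Real.exp (x - z) ≤ 1 := Real.exp_le_one_iff.2 (by linarith [hx.2])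
    linarith
  · apply setIntegral_mono_set (fermi_int β z hβ)
    · filter_upwards [ae_restrict_mem measurableSet_Ioi] with x hx
      have h1 : 0 < x ^ β := Real.rpow_pos_of_pos hx β
      simp only [Pi.zero_apply]
      positivity
    · exact Filter.Eventually.of_forall Ioc_subset_Ioi_self

lemma fermi_surj_s15 (β y : ℝ) (hβ : -1 < β) (hy : 0 < y) : ∃ z, fermi β z = y := by
  have hlow : ∃ a, fermi β a ≤ y := by
    have h : Filter.Tendsto (fun z => Real.exp z * ∫ x in Ioi (0:ℝ), Real.exp (-x) * x ^ β)
        Filter.atBot (nhds 0) := by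
      simpa using Real.tendsto_exp_atBot.mul_const (∫ x in Ioi (0:ℝ), Real.exp (-x) * x ^ β)
    obtain ⟨a, ha⟩ := (h.eventually (Iio_mem_nhds hy)).exists
    exact ⟨a, (fermi_le β a hβ).trans (le_of_lt ha)⟩
  have hhigh : ∃ b, y ≤ fermi β b := by
    have h : Filter.Tendsto (fun z : ℝ => z ^ (β + 1) / (β + 1) / 2) Filter.atTop Filter.atTop :=
      ((tendsto_rpow_atTop (by linarith)).atTop_div_const (by linarith)).atTop_div_const two_pos
    obtain ⟨b, hb, hb0⟩ := ((h.eventually_ge_atTop y).and (Filter.eventually_gt_atTop 0)).exists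
    exact ⟨b, hb.trans (fermi_ge β b hβ hb0)⟩
  obtain ⟨a, ha⟩ := hlow
  obtain ⟨b, hb⟩ := hhigh
  exact mem_range_of_exists_le_of_exists_ge (fermi_continuous β hβ) ⟨a, ha⟩ ⟨b, hb⟩

/-- Rescale so that the lower moments agree, then use that the two profiles cross exactly once. -/
lemma fermi_key (α a b : ℝ) (hα : 0 < α) (hab : a < b) :
    fermi α b * fermi (α - 1) a ^ (1 + 1 / α) < fermi α a * fermi (α - 1) b ^ (1 + 1 / α) := by
  have hβ : -1 < α - 1 := by linarith
  have hα' : -1 < α := by linarith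
  have hA := fermi_pos_s15 (α - 1) a hβ
  have hB := fermi_pos_s15 (α - 1) b hβ
  have hAB := fermi_strictMono_s15 (α - 1) hβ hab
  set A := fermi (α - 1) a with hAdef
  set B := fermi (α - 1) b with hBdef
  obtain ⟨c, hc⟩ : ∃ c, c = (B / A) ^ (1 / α) := ⟨_, rfl⟩
  have hBA : 1 < B / A := (one_lt_div hA).2 hAB
  have hc1 : 1 < c := by rw [hc]; exact Real.one_lt_rpow hBA (by positivity)
  have hc0 : 0 < c := by linarith
  have hcα : c ^ α = B / A := by
    rw [hc, ← Real.rpow_mul (by positivity), one_div_mul_cancel hα.ne', Real.rpow_one]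
  have hcα1 : c ^ (α + 1) = B ^ (1 + 1 / α) / A ^ (1 + 1 / α) := by
    rw [hc, ← Real.rpow_mul (by positivity), ← Real.div_rpow hB.le hA.le]
    congr 1
    field_simp
  have hs1 := fermi_scale (α - 1) c b hc0
  have hs2 := fermi_scale α c b hc0
  rw [sub_add_cancel, hcα, ← hBdef] at hs1
  have hm : ∫ x in Ioi (0:ℝ), x ^ (α - 1) / (1 + Real.exp (c * x - b)) = A := by
    have hBA0 : B / A * A = B := div_mul_cancel₀ _ hA.ne'
    exact (mul_left_cancel₀ (by positivity : B / A ≠ 0) (hBA0.trans hs1)).symm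
  have hlt : ∫ x in Ioi (0:ℝ), x ^ α / (1 + Real.exp (c * x - b)) < fermi α a := by
    obtain ⟨t, ht⟩ : ∃ t, t = (b - a) / (c - 1) := ⟨_, rfl⟩
    have ht0 : 0 < t := by rw [ht]; exact div_pos (by linarith) (by linarith)
    have htc : t * (c - 1) = b - a := by rw [ht]; exact div_mul_cancel₀ _ (by linarith)
    have i1 := fermi_int α a hα'
    have i2 := fermi_aux_int α c b hα' hc1.le
    have i3 := fermi_int (α - 1) a hβ
    have i4 := fermi_aux_int (α - 1) c b hβ hc1.le
    have hsplit : ∀ x : ℝ, 0 < x →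
        (x ^ α / (1 + Real.exp (x - a)) - x ^ α / (1 + Real.exp (c * x - b)))
        - t * (x ^ (α - 1) / (1 + Real.exp (x - a)) - x ^ (α - 1) / (1 + Real.exp (c * x - b)))
        = x ^ (α - 1) * ((x - t) * (Real.exp (c * x - b) - Real.exp (x - a)))
          / ((1 + Real.exp (x - a)) * (1 + Real.exp (c * x - b))) := by
      intro x hx
      have : x ^ α = x ^ (α - 1) * x := by
        rw [← Real.rpow_add_one hx.ne', sub_add_cancel]
      rw [this]
      have e1 : 1 + Real.exp (x - a) ≠ 0 := by positivity
      have e2 : 1 + Real.exp (c * x - b) ≠ 0 := by positivity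
      field_simp
      ring
    have hpos := fermi_aux_pos
      (fun x => (x ^ α / (1 + Real.exp (x - a)) - x ^ α / (1 + Real.exp (c * x - b)))
        - t * (x ^ (α - 1) / (1 + Real.exp (x - a)) - x ^ (α - 1) / (1 + Real.exp (c * x - b))))
      t ht0 ((i1.sub i2).sub ((i3.sub i4).const_mul t)) ?_ ?_
    · have j1 : IntegrableOn (fun x : ℝ => x ^ α / (1 + Real.exp (x - a))
          - x ^ α / (1 + Real.exp (c * x - b))) (Ioi 0) := i1.sub i2
      have j2 : IntegrableOn (fun x : ℝ => t * (x ^ (α - 1) / (1 + Real.exp (x - a))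
          - x ^ (α - 1) / (1 + Real.exp (c * x - b)))) (Ioi 0) := (i3.sub i4).const_mul t
      rw [integral_sub j1 j2, integral_const_mul,
        integral_sub i1 i2, integral_sub i3 i4, hm] at hpos
      have e1 : ∫ x in Ioi (0:ℝ), x ^ (α - 1) / (1 + Real.exp (x - a)) = A := rfl
      have e2 : ∫ x in Ioi (0:ℝ), x ^ α / (1 + Real.exp (x - a)) = fermi α a := rfl
      rw [e1, e2] at hpos
      linarith
    · intro x hx
      have hx' : 0 < x := hx
      have h1 : 0 < x ^ (α - 1) := Real.rpow_pos_of_pos hx' _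
      rw [hsplit x hx']
      have h2 : 0 ≤ (x - t) * (Real.exp (c * x - b) - Real.exp (x - a)) := by
        rcases le_total t x with h | h
        · apply mul_nonneg (by linarith)
          have : Real.exp (x - a) ≤ Real.exp (c * x - b) := Real.exp_le_exp.2 (by nlinarith)
          linarith
        · apply mul_nonneg_of_nonpos_of_nonpos (by linarith)
          have : Real.exp (c * x - b) ≤ Real.exp (x - a) := Real.exp_le_exp.2 (by nlinarith)
          linarith
      positivity
    · intro x hx
      have hx' : 0 < x := hx.1
      have h1 : 0 < x ^ (α - 1) := Real.rpow_pos_of_pos hx' _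
      rw [hsplit x hx']
      have h2 : 0 < (x - t) * (Real.exp (c * x - b) - Real.exp (x - a)) := by
        apply mul_pos_of_neg_of_neg (by linarith [hx.2])
        have : Real.exp (c * x - b) < Real.exp (x - a) :=
          Real.exp_lt_exp.2 (by nlinarith [hx.2])
        linarith
      positivity
  rw [hs2, hcα1]
  have hAp : 0 < A ^ (1 + 1 / α) := Real.rpow_pos_of_pos hA _
  have hBp : 0 < B ^ (1 + 1 / α) := Real.rpow_pos_of_pos hB _
  calc _ = (∫ x in Ioi (0:ℝ), x ^ α / (1 + Real.exp (c * x - b))) * B ^ (1 + 1 / α) := by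
        field_simp
    _ < _ := mul_lt_mul_of_pos_right hlt hBp

theorem fermiDiracPressure_ratio_strictAnti
    (d : ℕ) (hd : 2 ≤ d) (μ : ℝ) (hμ : 0 < μ) :
    StrictAntiOn (fun z : ℝ => fermiDiracPressure d μ z * z ^ (-(1 + 2 / (d : ℝ))))
      (Set.Ioi 0) := by
  intro y hy z hz hyz
  have hy0 : 0 < y := hy
  have hz0 : 0 < z := hz
  have hd0 : (0:ℝ) < d := by
    have : 0 < d := by omega
    exact_mod_cast this
  have hα : (0:ℝ) < (d:ℝ) / 2 := by positivity
  have hβ : -1 < (d:ℝ) / 2 - 1 := by linarith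
  have ha := Function.invFun_eq (fermi_surj_s15 ((d:ℝ) / 2 - 1) (2 * y / μ) hβ (by positivity))
  have hb := Function.invFun_eq (fermi_surj_s15 ((d:ℝ) / 2 - 1) (2 * z / μ) hβ (by positivity))
  simp only [fermiDiracPressure]
  set a := Function.invFun (fermi ((d : ℝ) / 2 - 1)) (2 * y / μ)
  set b := Function.invFun (fermi ((d : ℝ) / 2 - 1)) (2 * z / μ)
  have hab : a < b := by
    rw [← (fermi_strictMono_s15 _ hβ).lt_iff_lt, ha, hb]
    gcongr
  have key := fermi_key ((d:ℝ) / 2) a b hα hab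
  have hp : 1 + 1 / ((d:ℝ) / 2) = 1 + 2 / (d:ℝ) := by field_simp
  rw [ha, hb, hp, mul_div_right_comm, mul_div_right_comm,
    Real.mul_rpow (by positivity) hy0.le, Real.mul_rpow (by positivity) hz0.le] at key
  have hm : 0 < (2 / μ) ^ (1 + 2 / (d:ℝ)) := Real.rpow_pos_of_pos (by positivity) _
  have hyp : 0 < y ^ (1 + 2 / (d:ℝ)) := Real.rpow_pos_of_pos hy0 _
  have hzp : 0 < z ^ (1 + 2 / (d:ℝ)) := Real.rpow_pos_of_pos hz0 _
  have key2 : fermi ((d:ℝ) / 2) b * y ^ (1 + 2 / (d:ℝ))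
      < fermi ((d:ℝ) / 2) a * z ^ (1 + 2 / (d:ℝ)) := by
    refine lt_of_mul_lt_mul_left ?_ hm.le
    linarith
  rw [Real.rpow_neg hy0.le, Real.rpow_neg hz0.le, ← div_eq_mul_inv, ← div_eq_mul_inv,
    div_lt_div_iff₀ hzp hyp, mul_assoc, mul_assoc]
  exact mul_lt_mul_of_pos_left key2 (by positivity)
end
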